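/- arXiv:1806.03409 — 2 statements merged into one kernel-verified Lean document; each statement's English description precedes it below -/
import Mathlib

section
/- Let N ≥ 1, K ≥ 1, let c ∈ ℂ^N, and let C ∈ ℂ^{N×N} be the symmetric Toeplitz matrix with first column c, i.e. C_{n,k} = c_{|n−k|}. Let A ∈ ℂ^{N×K} have columns a_0, …, a_{K−1}, and for each k set Q(a_k) = Q₁(a_k) + Q₂(a_k), where [Q₁(a)]_{n,j} = a_{n+j} if n+j ≤ N−1 and 0 otherwise, and [Q₂(a)]_{n,j} = a_{n−j} if 1 ≤ j ≤ n and 0 otherwise. Let Q = [Q(a_0), Q(a_1), …, Q(a_{K−1})] ∈ ℂ^{N×KN} be the block concatenation. Then for every s ∈ ℂ^K, C A s = Q (s ⊗ c), where s ⊗ c ∈ ℂ^{KN} is the Kronecker product stacking the vectors s_k c. -/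
open Matrix Finset

/-- The symmetric Toeplitz matrix with first column `c`: `C_{n,k} = c_{|n-k|}`. -/
def symToeplitz {N : ℕ} (c : Fin N → ℂ) : Matrix (Fin N) (Fin N) ℂ :=
  Matrix.of fun n k => c ⟨(n : ℕ) - (k : ℕ) + ((k : ℕ) - (n : ℕ)), by omega⟩

/-- `[Q₁(a)]_{n,j} = a_{n+j}` if `n+j ≤ N-1`, and `0` otherwise. -/
def Q₁ {N : ℕ} (a : Fin N → ℂ) : Matrix (Fin N) (Fin N) ℂ :=
  Matrix.of fun n j => if h : (n : ℕ) + (j : ℕ) < N then a ⟨(n : ℕ) + (j : ℕ), h⟩ else 0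

/-- `[Q₂(a)]_{n,j} = a_{n-j}` if `1 ≤ j ≤ n`, and `0` otherwise. -/
def Q₂ {N : ℕ} (a : Fin N → ℂ) : Matrix (Fin N) (Fin N) ℂ :=
  Matrix.of fun n j =>
    if 1 ≤ (j : ℕ) ∧ (j : ℕ) ≤ (n : ℕ) then a ⟨(n : ℕ) - (j : ℕ), by omega⟩ else 0

theorem Q₁_apply_eq_sum {N : ℕ} (a : Fin N → ℂ) (n j : Fin N) :
    Q₁ a n j = ∑ k : Fin N, if (k : ℕ) = n + j then a k else 0 := by
  simp only [Q₁, Matrix.of_apply]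
  split_ifs with h
  · rw [Finset.sum_eq_single ⟨n + j, h⟩]
    · simp
    · intro k _ hk
      exact if_neg fun e => hk (Fin.ext e)
    · simp
  · exact (Finset.sum_eq_zero fun k _ => if_neg (by omega)).symm

theorem Q₂_apply_eq_sum {N : ℕ} (a : Fin N → ℂ) (n j : Fin N) :
    Q₂ a n j = ∑ k : Fin N, if (n : ℕ) = k + j ∧ k < n then a k else 0 := by
  simp only [Q₂, Matrix.of_apply]
  split_ifs with h
  · rw [Finset.sum_eq_single ⟨n - j, by omega⟩]
    · rw [if_pos]
      simp only [Fin.lt_def]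
      omega
    · intro k _ hk
      refine if_neg fun e => hk (Fin.ext ?_)
      simp only
      omega
    · simp
  · refine (Finset.sum_eq_zero fun k _ => if_neg ?_).symm
    rw [Fin.lt_def]
    omega

theorem symToeplitz_apply_eq_sum {N : ℕ} (c : Fin N → ℂ) (n k : Fin N) :
    symToeplitz c n k =
      ∑ j : Fin N, if (j : ℕ) = (n : ℕ) - k + ((k : ℕ) - n) then c j else 0 := by
  rw [Finset.sum_eq_single ⟨(n : ℕ) - k + ((k : ℕ) - n), by omega⟩]
  · simp [symToeplitz]
  · intro j _ hj
    exact if_neg fun e => hj (Fin.ext e)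
  · simp

theorem symToeplitz_mulVec {N : ℕ} (c a : Fin N → ℂ) :
    symToeplitz c *ᵥ a = (Q₁ a + Q₂ a) *ᵥ c := by
  ext n
  simp only [Matrix.mulVec, dotProduct, Matrix.add_apply, symToeplitz_apply_eq_sum,
    Q₁_apply_eq_sum, Q₂_apply_eq_sum, ← Finset.sum_add_distrib, Finset.sum_mul]
  rw [Finset.sum_comm]
  refine Finset.sum_congr rfl fun j _ => Finset.sum_congr rfl fun k _ => ?_
  simp only [Fin.lt_def]
  split_ifs <;> first | omega | ring

/-- With `C = Toeplitz{c}`, `Q(a_k) = Q₁(a_k) + Q₂(a_k)` for the columns `a_k` of `A`,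
and `Q = [Q(a_0), …, Q(a_{K-1})] ∈ ℂ^{N×KN}` the block concatenation (indexed here by
`Fin K × Fin N`), one has `C A s = Q (s ⊗ c)` for every `s ∈ ℂ^K`, where the Kronecker
product `s ⊗ c ∈ ℂ^{KN}` is the vector whose `k`-th block of length `N` is `s_k c`. -/
theorem toeplitz_mul_steering_eq_Q_kron {N K : ℕ} (hN : 1 ≤ N) (hK : 1 ≤ K)
    (c : Fin N → ℂ) (A : Matrix (Fin N) (Fin K) ℂ)
    (Q : Matrix (Fin N) (Fin K × Fin N) ℂ)
    (hQ : Q = Matrix.of fun n kj => (Q₁ (fun i => A i kj.1) + Q₂ (fun i => A i kj.1)) n kj.2) :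
    ∀ s : Fin K → ℂ,
      (symToeplitz c * A).mulVec s = Q.mulVec (fun kj => s kj.1 * c kj.2) := by
  intro s
  subst hQ
  have hcol (k : Fin K) := symToeplitz_mulVec c fun i => A i k
  ext n
  simp only [Matrix.mulVec, dotProduct, Fintype.sum_prod_type, Matrix.of_apply]
  refine Finset.sum_congr rfl fun k _ => ?_
  have hk := congrFun (hcol k) n
  simp only [Matrix.mulVec, dotProduct] at hk
  rw [Matrix.mul_apply, hk, Finset.sum_mul]
  exact Finset.sum_congr rfl fun j _ => by ring
end

section
/- Let Ψ ∈ ℂ^{N×UN} be written in N×N blocks Ψ = [Ψ_0, …, Ψ_{U−1}], let Σ_X ∈ ℂ^{U×U} be Hermitian positive semidefinite, let μ_0, …, μ_{M−1} ∈ ℂ^U, y_0, …, y_{M−1} ∈ ℂ^N, let α > 0, M ≥ 1, and ϑ_0, …, ϑ_{N−1} > 0. Define M₁ = Σ_{p,k} Ψ_pᴴ Ψ_k (Σ_X)_{k,p}, 𝔓_m = Ψ(μ_m ⊗ I_N) ∈ ℂ^{N×N}, and the real-valued function L(c) = −α M cᴴ M₁ c − α Σ_{m=0}^{M−1} ‖y_m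 − 𝔓_m c‖² − Σ_{n=0}^{N−1} ϑ_n |c_n|² on ℂ^N. Then H := α M M₁ + α Σ_{m=0}^{M−1} 𝔓_mᴴ 𝔓_m + diag(ϑ) is Hermitian positive definite, and ĉ := H^{−1} z with z := α Σ_{m=0}^{M−1} 𝔓_mᴴ y_m is the unique global maximizer of L; indeed L(c) = L(ĉ) − (c − ĉ)ᴴ H (c − ĉ) for all c ∈ ℂ^N. -/
open Matrix Finset
open scoped ComplexOrder

namespace Matrix

variable {n ι : Type*} [Fintype n] [Fintype ι]

/-- Weighting the Gram blocks `Ψ_pᴴ Ψ_k` by a positive semidefinite matrix gives a positive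
semidefinite sum. -/
theorem PosSemidef.sum_smul_conjTranspose_mul {S : Matrix ι ι ℂ}
    (hS : S.PosSemidef) (B : ι → Matrix n n ℂ) :
    (∑ p, ∑ k, S k p • ((B p)ᴴ * B k)).PosSemidef := by
  obtain ⟨r, v, rfl⟩ := posSemidef_iff_eq_sum_vecMulVec.mp hS
  have key : ∑ p, ∑ k, (∑ i, vecMulVec (v i) (star (v i))) k p • ((B p)ᴴ * B k)
      = ∑ i, (∑ p, v i p • B p)ᴴ * ∑ k, v i k • B k := by
    simp only [conjTranspose_sum, conjTranspose_smul, Finset.sum_mul_sum, sum_apply,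
      vecMulVec_apply, Pi.star_apply, Finset.sum_smul, Matrix.smul_mul, Matrix.mul_smul, smul_smul]
    rw [Finset.sum_comm (s := (univ : Finset (Fin r)))]
    refine Finset.sum_congr rfl fun p _ => ?_
    rw [Finset.sum_comm]
  rw [key]
  exact posSemidef_sum _ fun i _ => posSemidef_conjTranspose_mul_self _

theorem re_star_dotProduct_comm (v w : n → ℂ) : (star v ⬝ᵥ w).re = (star w ⬝ᵥ v).re := by
  simp only [dotProduct, Complex.re_sum, Pi.star_apply, RCLike.star_def, Complex.mul_re,
    Complex.conj_re, Complex.conj_im]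
  exact Finset.sum_congr rfl fun _ _ => by ring

theorem re_star_sub_dotProduct_sub (A : Matrix n n ℂ) (y c : n → ℂ) :
    (star (y - A *ᵥ c) ⬝ᵥ (y - A *ᵥ c)).re
      = (star y ⬝ᵥ y).re - 2 * (star c ⬝ᵥ Aᴴ *ᵥ y).re + (star c ⬝ᵥ (Aᴴ * A) *ᵥ c).re := by
  have h : ∀ w, star c ⬝ᵥ Aᴴ *ᵥ w = star (A *ᵥ c) ⬝ᵥ w := fun w => by
    rw [star_mulVec, dotProduct_mulVec]
  rw [← mulVec_mulVec, h, h, star_sub, sub_dotProduct, dotProduct_sub, dotProduct_sub]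
  simp only [Complex.sub_re]
  rw [re_star_dotProduct_comm y (A *ᵥ c)]
  ring

/-- Completing the square for a Hermitian quadratic form. -/
theorem IsHermitian.completing_square {H : Matrix n n ℂ} (hH : H.IsHermitian) (x c : n → ℂ) :
    (star c ⬝ᵥ H *ᵥ c).re - 2 * (star c ⬝ᵥ H *ᵥ x).re
      = (star (c - x) ⬝ᵥ H *ᵥ (c - x)).re - (star x ⬝ᵥ H *ᵥ x).re := by
  have h : (star x ⬝ᵥ H *ᵥ c).re = (star c ⬝ᵥ H *ᵥ x).re := by
    rw [re_star_dotProduct_comm, star_mulVec, hH.eq, ← dotProduct_mulVec]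
  rw [mulVec_sub, star_sub, sub_dotProduct, dotProduct_sub, dotProduct_sub]
  simp only [Complex.sub_re, h]
  ring

end Matrix

/-- **The mutual coupling update `ĉ = H⁻¹ z`** (equation (ctE) of the paper).
With `M₁ = ∑_{p,k} Ψ_pᴴ Ψ_k (Σ_X)_{k,p}`, `𝔓_m = Ψ(μ_m ⊗ I_N)`, and the EM surrogate
`L(c) = −αM cᴴM₁c − α ∑_m ‖y_m − 𝔓_m c‖² − ∑_n ϑ_n |c_n|²`, the matrix
`H = αM M₁ + α ∑_m 𝔓_mᴴ 𝔓_m + diag(ϑ)` is Hermitian positive definite, and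
`ĉ = H⁻¹ z` with `z = α ∑_m 𝔓_mᴴ y_m` is the unique global maximizer of `L`;
indeed `L(c) = L(ĉ) − (c − ĉ)ᴴ H (c − ĉ)` for all `c`. -/
theorem coupling_update_unique_maximizer {N U M : ℕ} (hM : 1 ≤ M)
    (Ψ : Matrix (Fin N) (Fin U × Fin N) ℂ)
    (Ψb : Fin U → Matrix (Fin N) (Fin N) ℂ)
    (hΨb : ∀ u, Ψb u = Matrix.of fun i j => Ψ i (u, j))
    (SigX : Matrix (Fin U) (Fin U) ℂ) (hSigX : SigX.PosSemidef)
    (μ : Fin M → Fin U → ℂ) (y : Fin M → Fin N → ℂ)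
    (α : ℝ) (hα : 0 < α) (ϑ : Fin N → ℝ) (hϑ : ∀ n, 0 < ϑ n)
    (M₁ : Matrix (Fin N) (Fin N) ℂ)
    (hM₁ : M₁ = ∑ p, ∑ k, SigX k p • ((Ψb p)ᴴ * Ψb k))
    (P : Fin M → Matrix (Fin N) (Fin N) ℂ)
    (hP : ∀ m, P m = ∑ u, μ m u • Ψb u)
    (L : (Fin N → ℂ) → ℝ)
    (hL : ∀ c, L c = -(α * M) * (star c ⬝ᵥ M₁.mulVec c).re
        - α * ∑ m, (star (y m - (P m).mulVec c) ⬝ᵥ (y m - (P m).mulVec c)).re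
        - ∑ n, ϑ n * Complex.normSq (c n))
    (H : Matrix (Fin N) (Fin N) ℂ)
    (hH : H = ((α : ℂ) * (M : ℂ)) • M₁ + (α : ℂ) • (∑ m, (P m)ᴴ * P m)
        + Matrix.diagonal fun n => (ϑ n : ℂ))
    (z : Fin N → ℂ) (hz : z = (α : ℂ) • ∑ m, (P m)ᴴ.mulVec (y m))
    (chat : Fin N → ℂ) (hchat : chat = H⁻¹.mulVec z) :
    H.PosDef
    ∧ (∀ c, L c = L chat - (star (c - chat) ⬝ᵥ H.mulVec (c - chat)).re)
    ∧ ∀ c, L c ≤ L chat ∧ (L c = L chat ↔ c = chat) := by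

  have hM₁psd : M₁.PosSemidef := hM₁ ▸ hSigX.sum_smul_conjTranspose_mul Ψb
  have hpos : H.PosDef := by
    rw [hH]
    refine PosDef.posSemidef_add (PosSemidef.add ?_ ?_) ?_
    · exact hM₁psd.smul (by exact_mod_cast mul_nonneg hα.le (Nat.cast_nonneg M))
    · exact (posSemidef_sum _ fun m _ => posSemidef_conjTranspose_mul_self (P m)).smul
        (by exact_mod_cast hα.le)
    · exact PosDef.diagonal fun n => by exact_mod_cast hϑ n
  have hHchat : H *ᵥ chat = z := by
    rw [hchat, mulVec_mulVec, mul_nonsing_inv _ ((isUnit_iff_isUnit_det H).mp hpos.isUnit),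
      one_mulVec]
  have hquad : ∀ c, L c = -((star c ⬝ᵥ H *ᵥ c).re - 2 * (star c ⬝ᵥ H *ᵥ chat).re)
      - α * ∑ m, (star (y m) ⬝ᵥ y m).re := by
    intro c
    have hdiag : (star c ⬝ᵥ (diagonal fun n => (ϑ n : ℂ)) *ᵥ c).re
        = ∑ n, ϑ n * Complex.normSq (c n) := by
      simp only [dotProduct, mulVec_diagonal, Complex.re_sum, Pi.star_apply, RCLike.star_def]
      refine Finset.sum_congr rfl fun n _ => ?_
      simp [Complex.normSq_apply]
      ring
    have hHc : (star c ⬝ᵥ H *ᵥ c).re = α * M * (star c ⬝ᵥ M₁ *ᵥ c).re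
        + α * ∑ m, (star c ⬝ᵥ ((P m)ᴴ * P m) *ᵥ c).re + ∑ n, ϑ n * Complex.normSq (c n) := by
      rw [hH, add_mulVec, add_mulVec, dotProduct_add, dotProduct_add, Complex.add_re,
        Complex.add_re, hdiag, smul_mulVec, smul_mulVec, sum_mulVec, dotProduct_smul,
        dotProduct_smul, dotProduct_sum, smul_eq_mul, smul_eq_mul, ← Complex.ofReal_natCast,
        ← Complex.ofReal_mul, Complex.re_ofReal_mul, Complex.re_ofReal_mul, Complex.re_sum]
    have hzc : (star c ⬝ᵥ z).re = α * ∑ m, (star c ⬝ᵥ (P m)ᴴ *ᵥ y m).re := by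
      rw [hz, dotProduct_smul, dotProduct_sum, smul_eq_mul, Complex.re_ofReal_mul, Complex.re_sum]
    rw [hL, hHchat, hHc, hzc]
    simp only [re_star_sub_dotProduct_sub, Finset.sum_add_distrib, Finset.sum_sub_distrib,
      ← Finset.mul_sum]
    ring
  have hdecomp : ∀ c, L c = L chat - (star (c - chat) ⬝ᵥ H *ᵥ (c - chat)).re := by
    intro c
    have h := hpos.isHermitian.completing_square chat
    rw [hquad c, hquad chat, h c, h chat]
    simp only [sub_self, star_zero, zero_dotProduct, Complex.zero_re]
    ring
  refine ⟨hpos, hdecomp, fun c => ?_⟩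
  rcases eq_or_ne c chat with rfl | hc
  · simp
  · have hlt : 0 < (star (c - chat) ⬝ᵥ H *ᵥ (c - chat)).re :=
      hpos.re_dotProduct_pos (sub_ne_zero.mpr hc)
    have := hdecomp c
    exact ⟨by linarith, fun h => by linarith, fun h => absurd h hc⟩
end
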